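/- arXiv:2305.13432 — 3 statements merged into one kernel-verified Lean document; each statement's English description precedes it below -/
import Mathlib

section
/- Let X be a real Banach space, p ∈ (1,∞), μ ∈ (1/p,1], r ∈ (1/p,1) with r + μ > 1 + 1/p. Then there exists a constant C > 0, depending only on p, μ, r (in particular independent of T ∈ (0,∞]), such that for every strongly measurable function u : (0,T) → X satisfying ∫_0^T t^{(1-μ-r)p} ‖u(t)‖_X^p dt < ∞, one has (∫_0^T t^{(1-μ-r)p} ‖u(t)‖_X^p dt)^{1/p} ≤ C ( ‖u‖_{L_{p,μ}} + [u]_{W^r_{p,μ}} ). -/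
open MeasureTheory Set ENNReal

/-- Scaling of the Lebesgue integral on the line. -/
theorem aux_scale (c : ℝ) (hc : 0 < c) (g : ℝ → ℝ≥0∞) (hg : Measurable g) :
    ∫⁻ x, g (c * x) = ENNReal.ofReal c⁻¹ * ∫⁻ x, g x := by
  have h := Real.map_volume_mul_left hc.ne'
  rw [← lintegral_map (μ := volume) hg (measurable_const_mul c), h, lintegral_smul_measure,
    abs_of_pos (inv_pos.mpr hc), smul_eq_mul]

theorem aux_rpow (p a t x : ℝ) (hp : 0 < p) (ht : 0 < t) (hx : 0 ≤ x) :
    ENNReal.ofReal (t ^ (a / p) * x) ^ p = ENNReal.ofReal (t ^ a * x ^ p) := by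
  rw [ENNReal.ofReal_rpow_of_nonneg (by positivity) hp.le,
    Real.mul_rpow (by positivity) hx, ← Real.rpow_mul ht.le, div_mul_cancel₀ _ hp.ne']

theorem aux_meas (T : ℝ≥0∞) : MeasurableSet {t : ℝ | 0 < t ∧ ENNReal.ofReal t < T} :=
  (measurableSet_lt measurable_const measurable_id).inter
    (measurableSet_lt ENNReal.measurable_ofReal measurable_const)

/-- Dilation bound. -/
theorem aux_dil {X : Type*} [NormedAddCommGroup X] (p a l : ℝ)
    (hl : 0 < l) (hl1 : l ≤ 1) (T : ℝ≥0∞) (u : ℝ → X) (hu : StronglyMeasurable u) :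
    (∫⁻ t in {t : ℝ | 0 < t ∧ ENNReal.ofReal t < T},
      ENNReal.ofReal (t ^ a * ‖u (l * t)‖ ^ p)) ≤
    ENNReal.ofReal (l ^ (-a - 1)) * ∫⁻ t in {t : ℝ | 0 < t ∧ ENNReal.ofReal t < T},
      ENNReal.ofReal (t ^ a * ‖u t‖ ^ p) := by
  set S := {t : ℝ | 0 < t ∧ ENNReal.ofReal t < T} with hS
  have hSm : MeasurableSet S := aux_meas T
  have hum : Measurable (fun t => ‖u t‖) := hu.norm.measurable
  set G : ℝ → ℝ≥0∞ := S.indicator (fun t => ENNReal.ofReal (t ^ a * ‖u t‖ ^ p)) with hG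
  have hGm : Measurable G := Measurable.indicator (by fun_prop) hSm
  have h1 : (∫⁻ t in S, ENNReal.ofReal (t ^ a * ‖u (l * t)‖ ^ p)) ≤
      ∫⁻ t, ENNReal.ofReal (l ^ (-a)) * G (l * t) := by
    rw [← lintegral_indicator hSm]
    refine lintegral_mono fun t => ?_
    by_cases ht : t ∈ S
    · have hlt : l * t ∈ S := by
        refine ⟨mul_pos hl ht.1, lt_of_le_of_lt (ENNReal.ofReal_le_ofReal ?_) ht.2⟩
        nlinarith [ht.1]
      have ht0 : 0 < t := ht.1
      simp only [hG, indicator_of_mem ht, indicator_of_mem hlt]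
      rw [← ENNReal.ofReal_mul (by positivity), Real.mul_rpow hl.le ht0.le, ← mul_assoc,
        ← mul_assoc, ← Real.rpow_add hl, neg_add_cancel, Real.rpow_zero, one_mul]
    · simp [indicator_of_notMem ht]
  refine h1.trans (le_of_eq ?_)
  rw [lintegral_const_mul _ (by fun_prop), aux_scale l hl G hGm, ← mul_assoc,
    ← ENNReal.ofReal_mul (by positivity), hG, lintegral_indicator hSm,
    sub_eq_add_neg, Real.rpow_add hl, Real.rpow_neg_one]

/-- Averaged difference bound. -/
theorem aux_avg {X : Type*} [NormedAddCommGroup X] (p b q t : ℝ) (hb : 0 ≤ b) (hq : 0 ≤ q)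
    (ht : 0 < t) (u : ℝ → X) (hu : StronglyMeasurable u) :
    (∫⁻ l in Ioo (1/4 : ℝ) (1/2), ENNReal.ofReal (t ^ (b - q) * ‖u t - u (l * t)‖ ^ p)) ≤
    ENNReal.ofReal (4 ^ b) * ∫⁻ s in Ioo (0:ℝ) t,
      ENNReal.ofReal (s ^ b * ‖u t - u s‖ ^ p / (t - s) ^ (1 + q)) := by
  have hum : Measurable (fun s => ‖u t - u s‖) :=
    (stronglyMeasurable_const.sub hu).norm.measurable
  set G : ℝ → ℝ≥0∞ := (Ioo (0:ℝ) t).indicator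
    (fun s => ENNReal.ofReal (s ^ b * ‖u t - u s‖ ^ p / (t - s) ^ (1 + q))) with hG
  have hGm : Measurable G := Measurable.indicator (by fun_prop) measurableSet_Ioo
  have h1 : (∫⁻ l in Ioo (1/4 : ℝ) (1/2),
        ENNReal.ofReal (t ^ (b - q) * ‖u t - u (l * t)‖ ^ p)) ≤
      ∫⁻ l, ENNReal.ofReal (4 ^ b * t) * G (t * l) := by
    rw [← lintegral_indicator measurableSet_Ioo]
    refine lintegral_mono fun l => ?_
    by_cases hl : l ∈ Ioo (1/4 : ℝ) (1/2)
    · have hl0 : 0 < l := by linarith [hl.1]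
      have hlt : t * l ∈ Ioo (0:ℝ) t := ⟨by positivity, by nlinarith [hl.2]⟩
      simp only [hG, indicator_of_mem hl, indicator_of_mem hlt]
      rw [← ENNReal.ofReal_mul (by positivity)]
      refine ENNReal.ofReal_le_ofReal ?_
      rw [mul_comm l t]
      have hd : 0 < t - t * l := by linarith [hlt.2]
      have e1 : t ^ b ≤ 4 ^ b * (t * l) ^ b := by
        rw [← Real.mul_rpow (by norm_num) (by positivity)]
        exact Real.rpow_le_rpow ht.le (by nlinarith [hl.1]) hb
      have e2 : (t - t * l) ^ (1 + q) ≤ t * t ^ q := by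
        have : t * t ^ q = t ^ (1 + q) := by rw [Real.rpow_add ht, Real.rpow_one]
        rw [this]
        exact Real.rpow_le_rpow hd.le (by nlinarith) (by linarith)
      have hdq : 0 < (t - t * l) ^ (1 + q) := by positivity
      have htq : 0 < t ^ q := by positivity
      have e3 : 1 / t ^ q ≤ t / (t - t * l) ^ (1 + q) := by
        rw [div_le_div_iff₀ htq hdq]; linarith
      have hN : 0 ≤ ‖u t - u (t * l)‖ ^ p := by positivity
      calc t ^ (b - q) * ‖u t - u (t * l)‖ ^ p
          = t ^ b * (1 / t ^ q) * ‖u t - u (t * l)‖ ^ p := by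
            rw [Real.rpow_sub ht]; ring
        _ ≤ (4 ^ b * (t * l) ^ b) * (t / (t - t * l) ^ (1 + q)) * ‖u t - u (t * l)‖ ^ p := by
            gcongr
        _ = _ := by ring
    · rw [indicator_of_notMem hl]; exact zero_le
  refine h1.trans (le_of_eq ?_)
  rw [lintegral_const_mul _ (by fun_prop), aux_scale t ht G hGm, ← mul_assoc,
    ← ENNReal.ofReal_mul (by positivity), hG, lintegral_indicator measurableSet_Ioo,
    mul_assoc, mul_inv_cancel₀ ht.ne', mul_one]

/-- Absorption step. -/
theorem aux_abs {X : Type*} [NormedAddCommGroup X] (p a l θ : ℝ) (hp : 1 < p) (ha : a < -1)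
    (hl : 0 < l) (hl1 : l ≤ 1 / 2) (hθ : θ = (1 / 2 : ℝ) ^ ((-a - 1) / p))
    (T : ℝ≥0∞) (u : ℝ → X) (hu : StronglyMeasurable u)
    (hfin : (∫⁻ t in {t : ℝ | 0 < t ∧ ENNReal.ofReal t < T},
      ENNReal.ofReal (t ^ a * ‖u t‖ ^ p)) < ⊤) :
    ENNReal.ofReal (1 - θ) * (∫⁻ t in {t : ℝ | 0 < t ∧ ENNReal.ofReal t < T},
      ENNReal.ofReal (t ^ a * ‖u t‖ ^ p)) ^ (1 / p) ≤
    (∫⁻ t in {t : ℝ | 0 < t ∧ ENNReal.ofReal t < T},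
      ENNReal.ofReal (t ^ a * ‖u t - u (l * t)‖ ^ p)) ^ (1 / p) := by
  have hp0 : 0 < p := by linarith
  have hdil := aux_dil p a l hl (by linarith) T u hu
  set S := {t : ℝ | 0 < t ∧ ENNReal.ofReal t < T} with hS
  have hSm : MeasurableSet S := aux_meas T
  set I := ∫⁻ t in S, ENNReal.ofReal (t ^ a * ‖u t‖ ^ p) with hI
  set J := ∫⁻ t in S, ENNReal.ofReal (t ^ a * ‖u t - u (l * t)‖ ^ p) with hJ
  have hul : StronglyMeasurable (fun t => u (l * t)) :=
    hu.comp_measurable (measurable_const_mul l)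
  have m1 : Measurable (fun t => ‖u (l * t)‖) := hul.norm.measurable
  have m2 : Measurable (fun t => ‖u t - u (l * t)‖) := (hu.sub hul).norm.measurable
  have hθ0 : 0 ≤ θ := by rw [hθ]; positivity
  have key := ENNReal.lintegral_Lp_add_le (μ := volume.restrict S) (p := p)
    (f := fun t => ENNReal.ofReal (t ^ (a / p) * ‖u t - u (l * t)‖))
    (g := fun t => ENNReal.ofReal (t ^ (a / p) * ‖u (l * t)‖))
    (by fun_prop) (by fun_prop) hp.le
  have c1 : ∫⁻ t in S, ENNReal.ofReal (t ^ (a / p) * ‖u t - u (l * t)‖) ^ p = J :=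
    setLIntegral_congr_fun hSm fun t ht => aux_rpow p a t _ hp0 ht.1 (norm_nonneg _)
  have c2 : ∫⁻ t in S, ENNReal.ofReal (t ^ (a / p) * ‖u (l * t)‖) ^ p =
      ∫⁻ t in S, ENNReal.ofReal (t ^ a * ‖u (l * t)‖ ^ p) :=
    setLIntegral_congr_fun hSm fun t ht => aux_rpow p a t _ hp0 ht.1 (norm_nonneg _)
  rw [c1, c2] at key
  have c3 : I ≤ ∫⁻ t in S, ((fun t => ENNReal.ofReal (t ^ (a / p) * ‖u t - u (l * t)‖)) +
      (fun t => ENNReal.ofReal (t ^ (a / p) * ‖u (l * t)‖))) t ^ p := by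
    refine setLIntegral_mono' hSm fun t ht => ?_
    have ht0 : 0 < t := ht.1
    rw [← aux_rpow p a t _ hp0 ht0 (norm_nonneg _), Pi.add_apply,
      ← ENNReal.ofReal_add (by positivity) (by positivity), ← mul_add]
    refine ENNReal.rpow_le_rpow (ENNReal.ofReal_le_ofReal ?_) hp0.le
    gcongr
    simpa using norm_add_le (u t - u (l * t)) (u (l * t))
  have hp1 : 0 ≤ 1 / p := by positivity
  have c4 : (∫⁻ t in S, ENNReal.ofReal (t ^ a * ‖u (l * t)‖ ^ p)) ^ (1 / p) ≤
      ENNReal.ofReal θ * I ^ (1 / p) := by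
    refine (ENNReal.rpow_le_rpow hdil hp1).trans ?_
    rw [ENNReal.mul_rpow_of_nonneg _ _ hp1, ENNReal.ofReal_rpow_of_nonneg (by positivity) hp1,
      ← Real.rpow_mul hl.le, mul_one_div, hθ]
    gcongr
    exact div_nonneg (by linarith) hp0.le
  have c5 : I ^ (1 / p) ≤ J ^ (1 / p) + ENNReal.ofReal θ * I ^ (1 / p) :=
    (ENNReal.rpow_le_rpow c3 hp1).trans (key.trans (by gcongr))
  have hIf : I ^ (1 / p) ≠ ⊤ := ENNReal.rpow_ne_top_of_nonneg hp1 hfin.ne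
  rw [ENNReal.ofReal_sub _ hθ0, ENNReal.ofReal_one, ENNReal.sub_mul (fun _ _ => hIf), one_mul]
  exact tsub_le_iff_right.mpr c5

theorem stmt_2 {X : Type*} [NormedAddCommGroup X] [NormedSpace ℝ X] [CompleteSpace X]
    (p μ r : ℝ) (hp : 1 < p) (hμ : 1 / p < μ) (hμ1 : μ ≤ 1)
    (hr : 1 / p < r) (hr1 : r < 1) (hrμ : 1 + 1 / p < r + μ) :
    ∃ C : ℝ, 0 < C ∧
      ∀ (T : ℝ≥0∞), 0 < T →
        ∀ u : ℝ → X, StronglyMeasurable u →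
          (∫⁻ t in {t : ℝ | 0 < t ∧ ENNReal.ofReal t < T},
              ENNReal.ofReal (t ^ ((1 - μ - r) * p) * ‖u t‖ ^ p)) < ⊤ →
          (∫⁻ t in {t : ℝ | 0 < t ∧ ENNReal.ofReal t < T},
              ENNReal.ofReal (t ^ ((1 - μ - r) * p) * ‖u t‖ ^ p)) ^ (1 / p)
            ≤ ENNReal.ofReal C *
              ((∫⁻ t in {t : ℝ | 0 < t ∧ ENNReal.ofReal t < T},
                  ENNReal.ofReal (t ^ ((1 - μ) * p) * ‖u t‖ ^ p)) ^ (1 / p)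
               + (∫⁻ t in {t : ℝ | 0 < t ∧ ENNReal.ofReal t < T},
                    ∫⁻ s in Ioo (0 : ℝ) t,
                      ENNReal.ofReal
                        (s ^ ((1 - μ) * p) * ‖u t - u s‖ ^ p / (t - s) ^ (1 + r * p)))
                 ^ (1 / p)) := by
  
  have hp0 : 0 < p := by linarith
  have hp1 : 0 ≤ 1 / p := by positivity
  have ha : (1 - μ - r) * p < -1 := by
    have : (1 - μ - r) < - (1 / p) := by linarith
    calc (1 - μ - r) * p < -(1 / p) * p := by gcongr
      _ = -1 := by field_simp
  have hb : 0 ≤ (1 - μ) * p := mul_nonneg (by linarith) hp0.le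
  have hq : 0 ≤ r * p := mul_nonneg (by linarith [one_div_pos.mpr hp0]) hp0.le
  have hab : (1 - μ - r) * p = (1 - μ) * p - r * p := by ring
  obtain ⟨θ, hθ⟩ : ∃ θ : ℝ, θ = (1 / 2 : ℝ) ^ ((-((1 - μ - r) * p) - 1) / p) := ⟨_, rfl⟩
  have hθ1 : θ < 1 := by
    rw [hθ]
    exact Real.rpow_lt_one (by norm_num) (by norm_num) (div_pos (by linarith) hp0)
  have hθ' : 0 < 1 - θ := by linarith
  obtain ⟨K, hK⟩ : ∃ K : ℝ, K = (4 * 4 ^ ((1 - μ) * p)) ^ (1 / p) := ⟨_, rfl⟩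
  have hK0 : 0 < K := by rw [hK]; positivity
  refine ⟨(1 - θ)⁻¹ * K, by positivity, fun T _ u hu hfin => ?_⟩
  have habs := fun l (hl : l ∈ Ioo (1/4 : ℝ) (1/2)) =>
    aux_abs p ((1 - μ - r) * p) l θ hp ha (by linarith [hl.1]) hl.2.le hθ T u hu hfin
  set S := {t : ℝ | 0 < t ∧ ENNReal.ofReal t < T} with hS
  have hSm : MeasurableSet S := aux_meas T
  set I := ∫⁻ t in S, ENNReal.ofReal (t ^ ((1 - μ - r) * p) * ‖u t‖ ^ p) with hI
  set Q := ∫⁻ t in S, ∫⁻ s in Ioo (0 : ℝ) t,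
    ENNReal.ofReal (s ^ ((1 - μ) * p) * ‖u t - u s‖ ^ p / (t - s) ^ (1 + r * p)) with hQ
  -- the averaged difference
  have hA : (∫⁻ l in Ioo (1/4 : ℝ) (1/2), ∫⁻ t in S,
      ENNReal.ofReal (t ^ ((1 - μ - r) * p) * ‖u t - u (l * t)‖ ^ p)) ≤
      ENNReal.ofReal (4 ^ ((1 - μ) * p)) * Q := by
    have hm : Measurable (fun z : ℝ × ℝ => ‖u z.2 - u (z.1 * z.2)‖) :=
      ((hu.comp_measurable measurable_snd).sub
        (hu.comp_measurable (measurable_fst.mul measurable_snd))).norm.measurable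
    rw [lintegral_lintegral_swap (by
      apply Measurable.aemeasurable
      unfold Function.uncurry
      fun_prop), hQ, ← lintegral_const_mul' _ _ ENNReal.ofReal_ne_top]
    refine setLIntegral_mono' hSm fun t ht => ?_
    rw [hab]
    exact aux_avg p _ _ t hb hq ht.1 u hu
  have hB : ∫⁻ l in Ioo (1/4 : ℝ) (1/2), (ENNReal.ofReal (1 - θ) * I ^ (1 / p)) ^ p ≤
      ENNReal.ofReal (4 ^ ((1 - μ) * p)) * Q := by
    refine le_trans (setLIntegral_mono' measurableSet_Ioo fun l hl => ?_) hA
    have := ENNReal.rpow_le_rpow (habs l hl) hp0.le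
    rwa [← ENNReal.rpow_mul _ (1 / p) p, one_div_mul_cancel hp0.ne', ENNReal.rpow_one] at this
  rw [setLIntegral_const, Real.volume_Ioo] at hB
  have hC : (ENNReal.ofReal (1 - θ) * I ^ (1 / p)) ^ p ≤
      ENNReal.ofReal (4 * 4 ^ ((1 - μ) * p)) * Q := by
    rw [ENNReal.ofReal_mul (by norm_num), mul_assoc]
    calc (ENNReal.ofReal (1 - θ) * I ^ (1 / p)) ^ p
        = ENNReal.ofReal 4 * ((ENNReal.ofReal (1 - θ) * I ^ (1 / p)) ^ p *
            ENNReal.ofReal (1 / 2 - 1 / 4)) := by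
          rw [mul_comm (ENNReal.ofReal 4), mul_assoc, ← ENNReal.ofReal_mul (by norm_num)]
          norm_num
      _ ≤ _ := by gcongr
  have hD : ENNReal.ofReal (1 - θ) * I ^ (1 / p) ≤ ENNReal.ofReal K * Q ^ (1 / p) := by
    have := ENNReal.rpow_le_rpow hC hp1
    rwa [← ENNReal.rpow_mul _ p (1 / p), mul_one_div_cancel hp0.ne', ENNReal.rpow_one,
      ENNReal.mul_rpow_of_nonneg _ _ hp1, ENNReal.ofReal_rpow_of_nonneg (by positivity) hp1,
      ← hK] at this
  calc I ^ (1 / p) = ENNReal.ofReal (1 - θ)⁻¹ * (ENNReal.ofReal (1 - θ) * I ^ (1 / p)) := by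
        rw [← mul_assoc, ← ENNReal.ofReal_mul (by positivity), inv_mul_cancel₀ hθ'.ne',
          ENNReal.ofReal_one, one_mul]
    _ ≤ ENNReal.ofReal (1 - θ)⁻¹ * (ENNReal.ofReal K * Q ^ (1 / p)) := by gcongr
    _ = ENNReal.ofReal ((1 - θ)⁻¹ * K) * Q ^ (1 / p) := by
        rw [ENNReal.ofReal_mul (by positivity), mul_assoc]
    _ ≤ _ := by gcongr; exact le_add_self
end

section
/- Let X be a real Banach space, p ∈ (1,∞), μ ∈ (1/p,1], r ∈ (1/p,1) with r + μ > 1 + 1/p. Then there exists a constant C > 0, depending only on p, μ, r (independent of T ∈ (0,∞]), such that for every strongly measurable u : (0,T) → X satisfying ∫_0^T t^{(1-μ-r)p} ‖u(t)‖_X^p dt < ∞, the function (Φ_μ u)(t) := t^{1-μ} u(t) satisfies (∫_0^T ∫_0^t ‖t^{1-μ} u(t) - s^{1-μ} u(s)‖_X^p (t-s)^{-1-rp} ds dt)^{1/p} ≤ C ( ‖u‖_{L_{p,μ}} + [u]_{W^r_{p,μ}} ). -/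
open MeasureTheory Set ENNReal

lemma aux_scale_s4 (c : ℝ) (hc : 0 < c) (A B : Set ℝ) (hA : MeasurableSet A) (hB : MeasurableSet B)
    (h : ∀ x ∈ A, c * x ∈ B) (f : ℝ → ℝ≥0∞) :
    ENNReal.ofReal c * ∫⁻ x in A, f (c * x) ≤ ∫⁻ x in B, f x := by
  rw [← lintegral_indicator hA, ← lintegral_indicator hB]
  have h1 : ∫⁻ x, B.indicator f x = ENNReal.ofReal c * ∫⁻ x, B.indicator f (c * x) := by
    conv_lhs => rw [← Real.smul_map_volume_mul_left hc.ne']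
    rw [lintegral_smul_measure, abs_of_pos hc, smul_eq_mul]
    congr 1
    exact lintegral_map_equiv _ (Homeomorph.mulLeft₀ c hc.ne').toMeasurableEquiv
  rw [h1]
  gcongr with x
  by_cases hx : x ∈ A
  · simp [hx, h x hx]
  · simp [hx]

lemma aux_int (t q : ℝ) (ht : 0 < t) (hq : 0 < q) :
    ∫⁻ s in Ioo (0 : ℝ) t, ENNReal.ofReal ((t - s) ^ (q - 1)) = ENNReal.ofReal (t ^ q / q) := by
  have hi : IntervalIntegrable (fun s : ℝ => (t - s) ^ (q - 1)) volume 0 t := by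
    have := (intervalIntegral.intervalIntegrable_rpow' (a := t) (b := 0) (r := q - 1)
      (by linarith)).comp_sub_left t
    simpa using this
  rw [restrict_Ioo_eq_restrict_Ioc, ← ofReal_integral_eq_lintegral_ofReal]
  · rw [← intervalIntegral.integral_of_le ht.le,
      intervalIntegral.integral_comp_sub_left (fun s : ℝ => s ^ (q - 1)) t,
      integral_rpow (by left; linarith)]
    simp [Real.zero_rpow hq.ne']
  · exact (intervalIntegrable_iff_integrableOn_Ioc_of_le ht.le).1 hi
  · filter_upwards [ae_restrict_mem measurableSet_Ioc] with s hs
    exact Real.rpow_nonneg (by linarith [hs.2]) _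

lemma aux_diff (a t s : ℝ) (ha1 : a ≤ 1) (hs : 0 < s) (hst : s < t) :
    t ^ a - s ^ a ≤ t ^ (a - 1) * (t - s) := by
  have ht : 0 < t := hs.trans hst
  have h1 : s / t ≤ (s / t) ^ a := by
    have := Real.rpow_le_rpow_of_exponent_ge (x := s / t) (by positivity)
      ((div_le_one ht).2 hst.le) ha1
    simpa using this
  rw [Real.div_rpow hs.le ht.le, div_le_div_iff₀ ht (by positivity)] at h1
  rw [Real.rpow_sub_one ht.ne']
  have : t ^ a / t * (t - s) = t ^ a - s * t ^ a / t := by field_simp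
  rw [this]
  have : s * t ^ a / t ≤ s ^ a := (div_le_iff₀ ht).2 h1
  linarith

lemma aux_kernel (p a r t : ℝ) (hp : 1 < p) (ha : 0 ≤ a) (ha1 : a ≤ 1) (hr1 : r < 1)
    (ht : 0 < t) (n : ℝ) (hn : 0 ≤ n) :
    ∫⁻ s in Ioo (0 : ℝ) t,
      ENNReal.ofReal (((t ^ a - s ^ a) * n) ^ p / (t - s) ^ (1 + r * p)) ≤
    ENNReal.ofReal (1 / (p * (1 - r))) * ENNReal.ofReal (t ^ ((a - r) * p) * n ^ p) := by
  have hq : 0 < p * (1 - r) := mul_pos (by linarith) (by linarith)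
  calc _ ≤ ∫⁻ s in Ioo (0 : ℝ) t, ENNReal.ofReal (t ^ ((a - 1) * p) * n ^ p) *
        ENNReal.ofReal ((t - s) ^ (p * (1 - r) - 1)) := by
        refine setLIntegral_mono' measurableSet_Ioo fun s hs => ?_
        rw [← ENNReal.ofReal_mul (by positivity)]
        apply ENNReal.ofReal_le_ofReal
        have hts : 0 < t - s := by linarith [hs.2]
        have h0 : 0 ≤ t ^ a - s ^ a :=
          sub_nonneg.2 (Real.rpow_le_rpow hs.1.le hs.2.le ha)
        rw [div_le_iff₀ (by positivity)]
        calc ((t ^ a - s ^ a) * n) ^ p ≤ (t ^ (a - 1) * (t - s) * n) ^ p := by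
              have := aux_diff a t s ha1 hs.1 hs.2
              gcongr
          _ = _ := by
              rw [Real.mul_rpow (by positivity) hn, Real.mul_rpow (by positivity) hts.le,
                ← Real.rpow_mul ht.le]
              have : (t - s) ^ p = (t - s) ^ (p * (1 - r) - 1) * (t - s) ^ (1 + r * p) := by
                rw [← Real.rpow_add hts]; congr 1; ring
              rw [this]; ring
    _ = _ := by
        rw [lintegral_const_mul' _ _ ENNReal.ofReal_ne_top, aux_int t _ ht hq,
          ← ENNReal.ofReal_mul (by positivity), ← ENNReal.ofReal_mul (by positivity)]
        congr 1
        have : t ^ ((a - r) * p) = t ^ ((a - 1) * p) * t ^ (p * (1 - r)) := by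
          rw [← Real.rpow_add ht]; congr 1; ring
        rw [this]; ring

lemma aux_avg_s4 (p a r t : ℝ) (hp : 1 < p) (ha : 0 ≤ a) (hr : 0 < r) (ht : 0 < t)
    (n : ℝ → ℝ) (hn : ∀ s, 0 ≤ n s) :
    ∫⁻ θ in Ioo (1/4 : ℝ) (1/2), ENNReal.ofReal (t ^ ((a - r) * p) * n (θ * t) ^ p) ≤
    ENNReal.ofReal (4 ^ (a * p)) *
      ∫⁻ s in Ioo (0 : ℝ) t,
        ENNReal.ofReal (s ^ (a * p) * n s ^ p / (t - s) ^ (1 + r * p)) := by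
  set k : ℝ → ℝ≥0∞ := fun s =>
    ENNReal.ofReal (s ^ (a * p) * n s ^ p / (t - s) ^ (1 + r * p)) with hk
  calc _ ≤ ∫⁻ θ in Ioo (1/4 : ℝ) (1/2), ENNReal.ofReal (4 ^ (a * p)) *
        (ENNReal.ofReal t * k (t * θ)) := by
        refine setLIntegral_mono' measurableSet_Ioo fun θ hθ => ?_
        have h4 : (0 : ℝ) < θ := by linarith [hθ.1]
        have hts : 0 < t - t * θ := by nlinarith [hθ.2]
        have hnn := hn (t * θ)
        rw [hk]
        dsimp only
        rw [← ENNReal.ofReal_mul ht.le, ← ENNReal.ofReal_mul (by positivity), mul_comm θ t]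
        apply ENNReal.ofReal_le_ofReal
        have e1 : t ^ ((a - r) * p) = t * (t ^ (a * p) / t ^ (1 + r * p)) := by
          rw [← Real.rpow_sub ht]
          nth_rw 2 [← Real.rpow_one t]
          rw [← Real.rpow_add ht]; congr 1; ring
        have e2 : t ^ (a * p) ≤ 4 ^ (a * p) * (t * θ) ^ (a * p) := by
          rw [← Real.mul_rpow (by norm_num) (by positivity)]
          exact Real.rpow_le_rpow ht.le (by nlinarith [hθ.1]) (by positivity)
        have e3 : (t - t * θ) ^ (1 + r * p) ≤ t ^ (1 + r * p) :=
          Real.rpow_le_rpow hts.le (by nlinarith) (by positivity)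
        calc t ^ ((a - r) * p) * n (t * θ) ^ p
            = t * (t ^ (a * p) / t ^ (1 + r * p)) * n (t * θ) ^ p := by rw [e1]
          _ ≤ t * ((4 ^ (a * p) * (t * θ) ^ (a * p)) / (t - t * θ) ^ (1 + r * p))
              * n (t * θ) ^ p := by gcongr
          _ = _ := by ring
    _ = ENNReal.ofReal (4 ^ (a * p)) *
        (ENNReal.ofReal t * ∫⁻ θ in Ioo (1/4 : ℝ) (1/2), k (t * θ)) := by
        rw [lintegral_const_mul' _ _ ENNReal.ofReal_ne_top,
          lintegral_const_mul' _ _ ENNReal.ofReal_ne_top]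
    _ ≤ _ := by
        gcongr
        refine aux_scale_s4 t ht _ _ measurableSet_Ioo measurableSet_Ioo (fun x hx => ?_) k
        constructor <;> nlinarith [hx.1, hx.2]

lemma aux_fixed {X : Type*} [NormedAddCommGroup X]
    (p b : ℝ) (hp : 1 < p) (hb : 1 / p < b) (I : Set ℝ)
    (hI : MeasurableSet I) (hpos : ∀ t ∈ I, 0 < t)
    (hsub : ∀ t ∈ I, ∀ θ, 0 < θ → θ < 1 → θ * t ∈ I)
    (u : ℝ → X) (hu : StronglyMeasurable u)
    (hfin : (∫⁻ t in I, ENNReal.ofReal (t ^ (-b * p) * ‖u t‖ ^ p)) < ⊤)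
    (θ : ℝ) (hθ : 0 < θ) (hθ2 : θ < 1 / 2) :
    ENNReal.ofReal ((1 - (1/2) ^ (b - 1/p)) ^ p) *
      (∫⁻ t in I, ENNReal.ofReal (t ^ (-b * p) * ‖u t‖ ^ p)) ≤
      ∫⁻ t in I, ENNReal.ofReal (t ^ (-b * p) * ‖u t - u (θ * t)‖ ^ p) := by
  have hp0 : 0 < p := by linarith
  set H := ∫⁻ t in I, ENNReal.ofReal (t ^ (-b * p) * ‖u t‖ ^ p) with hH
  set D := ∫⁻ t in I, ENNReal.ofReal (t ^ (-b * p) * ‖u t - u (θ * t)‖ ^ p) with hD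
  have hu2 : StronglyMeasurable fun t => u (θ * t) := hu.comp_measurable (by fun_prop)
  have hpw : ∀ t ∈ I, ∀ x : ℝ, 0 ≤ x →
      ENNReal.ofReal (t ^ (-b * p) * x ^ p) = ENNReal.ofReal (t ^ (-b) * x) ^ p := by
    intro t ht x hx
    have := hpos t ht
    rw [ENNReal.ofReal_rpow_of_nonneg (by positivity) hp0.le,
      Real.mul_rpow (by positivity) hx, ← Real.rpow_mul this.le]
  have hsc : (∫⁻ t in I, ENNReal.ofReal (t ^ (-b * p) * ‖u (θ * t)‖ ^ p)) ≤
      ENNReal.ofReal (θ ^ (b * p - 1)) * H := by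
    have h1 := aux_scale_s4 θ hθ I I hI hI (fun t ht => hsub t ht θ hθ (by linarith))
      (fun t => ENNReal.ofReal (t ^ (-b * p) * ‖u t‖ ^ p))
    calc _ = ∫⁻ t in I, ENNReal.ofReal (θ ^ (b * p - 1)) * (ENNReal.ofReal θ *
          ENNReal.ofReal ((θ * t) ^ (-b * p) * ‖u (θ * t)‖ ^ p)) := by
          refine setLIntegral_congr_fun hI fun t ht => ?_
          have := hpos t ht
          rw [← ENNReal.ofReal_mul hθ.le, ← ENNReal.ofReal_mul (by positivity),
            Real.mul_rpow hθ.le this.le]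
          congr 1
          have : θ ^ (b * p - 1) * θ * θ ^ (-b * p) = 1 := by
            rw [← Real.rpow_add_one hθ.ne', ← Real.rpow_add hθ]; ring_nf; simp
          linear_combination (-(t ^ (-b * p) * ‖u (θ * t)‖ ^ p)) * this
      _ = ENNReal.ofReal (θ ^ (b * p - 1)) * (ENNReal.ofReal θ * ∫⁻ t in I,
          ENNReal.ofReal ((θ * t) ^ (-b * p) * ‖u (θ * t)‖ ^ p)) := by
          rw [lintegral_const_mul' _ _ ENNReal.ofReal_ne_top,
            lintegral_const_mul' _ _ ENNReal.ofReal_ne_top]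
      _ ≤ _ := by gcongr
  have hgam : 0 < b - 1 / p := by linarith
  have hmink : H ^ (1 / p) ≤ D ^ (1 / p) +
      (∫⁻ t in I, ENNReal.ofReal (t ^ (-b * p) * ‖u (θ * t)‖ ^ p)) ^ (1 / p) := by
    have e1 : H ≤ ∫⁻ t in I, (((fun t => ENNReal.ofReal (t ^ (-b) * ‖u t - u (θ * t)‖)) +
        (fun t => ENNReal.ofReal (t ^ (-b) * ‖u (θ * t)‖))) t) ^ p := by
      refine setLIntegral_mono' hI fun t ht => ?_
      have := hpos t ht
      rw [hpw t ht _ (norm_nonneg _), Pi.add_apply, ← ENNReal.ofReal_add (by positivity)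
        (by positivity), ← mul_add]
      gcongr
      calc ‖u t‖ = ‖(u t - u (θ * t)) + u (θ * t)‖ := by simp
        _ ≤ _ := norm_add_le _ _
    have e2 : D = ∫⁻ t in I, ENNReal.ofReal (t ^ (-b) * ‖u t - u (θ * t)‖) ^ p :=
      setLIntegral_congr_fun hI fun t ht => hpw t ht _ (norm_nonneg _)
    have e3 : (∫⁻ t in I, ENNReal.ofReal (t ^ (-b * p) * ‖u (θ * t)‖ ^ p)) =
        ∫⁻ t in I, ENNReal.ofReal (t ^ (-b) * ‖u (θ * t)‖) ^ p :=
      setLIntegral_congr_fun hI fun t ht => hpw t ht _ (norm_nonneg _)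
    rw [e2, e3]
    refine (ENNReal.rpow_le_rpow e1 (by positivity)).trans ?_
    have m1 := (hu.sub hu2).norm.measurable
    have m2 := hu2.norm.measurable
    have m0 : Measurable fun t : ℝ => t ^ (-b) := by fun_prop
    refine ENNReal.lintegral_Lp_add_le ?_ ?_ hp.le
    · exact (m0.mul m1).ennreal_ofReal.aemeasurable
    · exact (m0.mul m2).ennreal_ofReal.aemeasurable
  have hc : (∫⁻ t in I, ENNReal.ofReal (t ^ (-b * p) * ‖u (θ * t)‖ ^ p)) ^ (1 / p) ≤
      ENNReal.ofReal ((1/2) ^ (b - 1/p)) * H ^ (1 / p) := by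
    refine (ENNReal.rpow_le_rpow hsc (by positivity)).trans ?_
    rw [ENNReal.mul_rpow_of_nonneg _ _ (by positivity),
      ENNReal.ofReal_rpow_of_nonneg (by positivity) (by positivity), ← Real.rpow_mul hθ.le]
    gcongr
    have : (b * p - 1) * (1 / p) = b - 1 / p := by field_simp
    rw [this]
    exact Real.rpow_le_rpow hθ.le hθ2.le hgam.le
  have hlt : ((1/2 : ℝ)) ^ (b - 1/p) < 1 := Real.rpow_lt_one (by norm_num) (by norm_num) hgam
  have hHp : H ^ (1 / p) ≠ ⊤ := ENNReal.rpow_ne_top_of_nonneg (by positivity) hfin.ne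
  have hfinal : ENNReal.ofReal (1 - (1/2) ^ (b - 1/p)) * H ^ (1 / p) ≤ D ^ (1 / p) := by
    have h := hmink.trans (add_le_add_right hc (D ^ (1 / p)))
    rw [ENNReal.ofReal_sub _ (by positivity), ENNReal.ofReal_one,
      ENNReal.sub_mul (fun _ _ => hHp), one_mul]
    exact tsub_le_iff_right.2 h
  have := ENNReal.rpow_le_rpow hfinal hp0.le
  rw [ENNReal.mul_rpow_of_nonneg _ _ hp0.le, ← ENNReal.rpow_mul, ← ENNReal.rpow_mul,
    one_div_mul_cancel hp0.ne', ENNReal.rpow_one, ENNReal.rpow_one,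
    ENNReal.ofReal_rpow_of_nonneg (by linarith) hp0.le] at this
  exact this

lemma aux_hardy {X : Type*} [NormedAddCommGroup X]
    (p a r : ℝ) (hp : 1 < p) (ha : 0 ≤ a) (hr : 0 < r) (hb : 1 / p < r - a) (I : Set ℝ)
    (hI : MeasurableSet I) (hpos : ∀ t ∈ I, 0 < t)
    (hsub : ∀ t ∈ I, ∀ θ, 0 < θ → θ < 1 → θ * t ∈ I)
    (u : ℝ → X) (hu : StronglyMeasurable u)
    (hfin : (∫⁻ t in I, ENNReal.ofReal (t ^ ((a - r) * p) * ‖u t‖ ^ p)) < ⊤) :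
    ENNReal.ofReal ((1 - (1/2) ^ (r - a - 1/p)) ^ p * (1/4)) *
      (∫⁻ t in I, ENNReal.ofReal (t ^ ((a - r) * p) * ‖u t‖ ^ p)) ≤
    ENNReal.ofReal (4 ^ (a * p)) * ∫⁻ t in I, ∫⁻ s in Ioo (0 : ℝ) t,
        ENNReal.ofReal (s ^ (a * p) * ‖u t - u s‖ ^ p / (t - s) ^ (1 + r * p)) := by
  have hab : a - r = -(r - a) := by ring
  set H := (∫⁻ t in I, ENNReal.ofReal (t ^ ((a - r) * p) * ‖u t‖ ^ p)) with hH
  have hlt : ((1/2 : ℝ)) ^ (r - a - 1/p) < 1 :=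
    Real.rpow_lt_one (by norm_num) (by norm_num) (by linarith)
  calc _ = ∫⁻ θ in Ioo (1/4 : ℝ) (1/2),
        ENNReal.ofReal ((1 - (1/2) ^ (r - a - 1/p)) ^ p) * H := by
        rw [setLIntegral_const, Real.volume_Ioo, ENNReal.ofReal_mul
          (Real.rpow_nonneg (by linarith) _), mul_right_comm]
        norm_num
    _ ≤ ∫⁻ θ in Ioo (1/4 : ℝ) (1/2), ∫⁻ t in I,
        ENNReal.ofReal (t ^ ((a - r) * p) * ‖u t - u (θ * t)‖ ^ p) := by
        refine setLIntegral_mono' measurableSet_Ioo fun θ hθ => ?_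
        rw [hH, hab]
        rw [hH, hab] at hfin
        exact aux_fixed p (r - a) hp hb I hI hpos hsub u hu hfin θ (by linarith [hθ.1]) hθ.2
    _ = ∫⁻ t in I, ∫⁻ θ in Ioo (1/4 : ℝ) (1/2),
        ENNReal.ofReal (t ^ ((a - r) * p) * ‖u t - u (θ * t)‖ ^ p) := by
        refine lintegral_lintegral_swap ?_
        have m1 : StronglyMeasurable fun z : ℝ × ℝ => u z.2 - u (z.1 * z.2) :=
          (hu.comp_measurable measurable_snd).sub (hu.comp_measurable (by fun_prop))
        have m2 := m1.norm.measurable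
        have m3 : Measurable fun z : ℝ × ℝ =>
            ENNReal.ofReal (z.2 ^ ((a - r) * p) * ‖u z.2 - u (z.1 * z.2)‖ ^ p) := by
          fun_prop
        exact m3.aemeasurable
    _ ≤ ∫⁻ t in I, ENNReal.ofReal (4 ^ (a * p)) * ∫⁻ s in Ioo (0 : ℝ) t,
        ENNReal.ofReal (s ^ (a * p) * ‖u t - u s‖ ^ p / (t - s) ^ (1 + r * p)) := by
        refine setLIntegral_mono' hI fun t ht => ?_
        exact aux_avg_s4 p a r t hp ha hr (hpos t ht) (fun s => ‖u t - u s‖)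
          (fun _ => norm_nonneg _)
    _ = _ := lintegral_const_mul' _ _ ENNReal.ofReal_ne_top

lemma aux_split {X : Type*} [NormedAddCommGroup X] [NormedSpace ℝ X]
    (p a r : ℝ) (hp : 1 < p) (ha : 0 ≤ a) (ha1 : a ≤ 1) (hr1 : r < 1) (I : Set ℝ)
    (hI : MeasurableSet I) (hpos : ∀ t ∈ I, 0 < t)
    (u : ℝ → X) (hu : StronglyMeasurable u) :
    (∫⁻ t in I, ∫⁻ s in Ioo (0 : ℝ) t, ENNReal.ofReal
        (‖t ^ a • u t - s ^ a • u s‖ ^ p / (t - s) ^ (1 + r * p))) ≤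
    ENNReal.ofReal (2 ^ p) * ((∫⁻ t in I, ∫⁻ s in Ioo (0 : ℝ) t, ENNReal.ofReal
        (s ^ (a * p) * ‖u t - u s‖ ^ p / (t - s) ^ (1 + r * p))) +
      ENNReal.ofReal (1 / (p * (1 - r))) *
        ∫⁻ t in I, ENNReal.ofReal (t ^ ((a - r) * p) * ‖u t‖ ^ p)) := by
  have hp0 : 0 < p := by linarith
  calc _ ≤ ∫⁻ t in I, ENNReal.ofReal (2 ^ p) * ((∫⁻ s in Ioo (0 : ℝ) t, ENNReal.ofReal
        (s ^ (a * p) * ‖u t - u s‖ ^ p / (t - s) ^ (1 + r * p))) +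
        ENNReal.ofReal (1 / (p * (1 - r))) *
          ENNReal.ofReal (t ^ ((a - r) * p) * ‖u t‖ ^ p)) := by
        refine setLIntegral_mono' hI fun t ht => ?_
        have ht0 := hpos t ht
        refine le_trans ?_ (mul_le_mul_right (add_le_add_right
          (aux_kernel p a r t hp ha ha1 hr1 ht0 ‖u t‖ (norm_nonneg _)) _) _)
        rw [← lintegral_add_right _ (by fun_prop),
          ← lintegral_const_mul' _ _ ENNReal.ofReal_ne_top]
        refine setLIntegral_mono' measurableSet_Ioo fun s hs => ?_
        have hs0 := hs.1
        have hts : 0 < t - s := by linarith [hs.2]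
        have h0 : 0 ≤ t ^ a - s ^ a :=
          sub_nonneg.2 (Real.rpow_le_rpow hs.1.le hs.2.le ha)
        rw [← ENNReal.ofReal_add (by positivity) (by positivity),
          ← ENNReal.ofReal_mul (by positivity)]
        apply ENNReal.ofReal_le_ofReal
        rw [← add_div, ← mul_div_assoc]
        gcongr
        have e1 : ‖t ^ a • u t - s ^ a • u s‖ ≤
            s ^ a * ‖u t - u s‖ + (t ^ a - s ^ a) * ‖u t‖ := by
          have : t ^ a • u t - s ^ a • u s = s ^ a • (u t - u s) + (t ^ a - s ^ a) • u t := by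
            rw [smul_sub, sub_smul]; abel
          rw [this]
          refine (norm_add_le _ _).trans ?_
          rw [norm_smul, norm_smul, Real.norm_of_nonneg h0, Real.norm_of_nonneg (by positivity)]
        set x := s ^ a * ‖u t - u s‖ with hx
        set y := (t ^ a - s ^ a) * ‖u t‖ with hy
        have hx0 : 0 ≤ x := by positivity
        have hy0 : 0 ≤ y := by positivity
        have e2 : s ^ (a * p) * ‖u t - u s‖ ^ p = x ^ p := by
          rw [hx, Real.mul_rpow (by positivity) (norm_nonneg _), ← Real.rpow_mul hs0.le]
        rw [e2]
        calc _ ≤ (x + y) ^ p := by gcongr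
          _ ≤ (2 * max x y) ^ p := by
              gcongr
              linarith [le_max_left x y, le_max_right x y]
          _ = 2 ^ p * (max x y) ^ p := Real.mul_rpow (by norm_num) (le_max_of_le_left hx0)
          _ ≤ _ := by
              gcongr
              have := Real.rpow_nonneg hx0 p
              have := Real.rpow_nonneg hy0 p
              rcases max_cases x y with h | h <;> rw [h.1] <;> linarith
    _ = _ := by
        rw [lintegral_const_mul' _ _ ENNReal.ofReal_ne_top, lintegral_add_right,
          lintegral_const_mul' _ _ ENNReal.ofReal_ne_top]
        have := hu.norm.measurable
        fun_prop



/-- Lemma A.3 of the paper, first estimate (intrinsic norms): for `p ∈ (1,∞)`,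
`μ ∈ (1/p,1]`, `r ∈ (1/p,1)` with `r + μ > 1 + 1/p`, there is `C > 0` independent of
`T ∈ (0,∞]` such that the unweighted Sobolev–Slobodeckij seminorm of
`(Φ_μ u)(t) = t^(1-μ) u(t)` is bounded by `C (‖u‖_{L_{p,μ}} + [u]_{W^r_{p,μ}})`,
for every strongly measurable `u` with `∫_0^T t^((1-μ-r)p) ‖u(t)‖^p dt < ∞`. -/
theorem stmt_4 {X : Type*} [NormedAddCommGroup X] [NormedSpace ℝ X] [CompleteSpace X]
    (p μ r : ℝ) (hp : 1 < p) (hμ : 1 / p < μ) (hμ1 : μ ≤ 1)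
    (hr : 1 / p < r) (hr1 : r < 1) (hrμ : 1 + 1 / p < r + μ) :
    ∃ C : ℝ, 0 < C ∧
      ∀ (T : ℝ≥0∞), 0 < T →
        ∀ u : ℝ → X, StronglyMeasurable u →
          (∫⁻ t in {t : ℝ | 0 < t ∧ ENNReal.ofReal t < T},
              ENNReal.ofReal (t ^ ((1 - μ - r) * p) * ‖u t‖ ^ p)) < ⊤ →
          (∫⁻ t in {t : ℝ | 0 < t ∧ ENNReal.ofReal t < T},
              ∫⁻ s in Ioo (0 : ℝ) t,
                ENNReal.ofReal
                  (‖t ^ (1 - μ) • u t - s ^ (1 - μ) • u s‖ ^ p / (t - s) ^ (1 + r * p)))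
            ^ (1 / p)
            ≤ ENNReal.ofReal C *
              ((∫⁻ t in {t : ℝ | 0 < t ∧ ENNReal.ofReal t < T},
                  ENNReal.ofReal (t ^ ((1 - μ) * p) * ‖u t‖ ^ p)) ^ (1 / p)
               + (∫⁻ t in {t : ℝ | 0 < t ∧ ENNReal.ofReal t < T},
                    ∫⁻ s in Ioo (0 : ℝ) t,
                      ENNReal.ofReal
                        (s ^ ((1 - μ) * p) * ‖u t - u s‖ ^ p / (t - s) ^ (1 + r * p)))
                 ^ (1 / p)) := by
  set a : ℝ := 1 - μ with ha_def
  have hp0 : 0 < p := by linarith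
  have hip : 0 < 1 / p := by positivity
  have ha : 0 ≤ a := by linarith
  have ha1 : a ≤ 1 := by linarith
  have hr0 : 0 < r := by linarith
  have hb : 1 / p < r - a := by linarith
  have hlt : ((1/2 : ℝ)) ^ (r - a - 1/p) < 1 :=
    Real.rpow_lt_one (by norm_num) (by norm_num) (by linarith)
  obtain ⟨k, hk⟩ : ∃ k, k = (1 - (1/2 : ℝ) ^ (r - a - 1/p)) ^ p * (1/4) := ⟨_, rfl⟩
  have hk0 : 0 < k := by
    rw [hk]
    have : 0 < 1 - (1/2 : ℝ) ^ (r - a - 1/p) := by linarith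
    positivity
  obtain ⟨q, hq⟩ : ∃ q, q = 1 / (p * (1 - r)) := ⟨_, rfl⟩
  have hq0 : 0 < q := by
    rw [hq]
    have : 0 < 1 - r := by linarith
    positivity
  refine ⟨(2 ^ p * (1 + q * (k⁻¹ * 4 ^ (a * p)))) ^ (1 / p), by positivity, ?_⟩
  intro T hT u hu hfin
  have hI : MeasurableSet {t : ℝ | 0 < t ∧ ENNReal.ofReal t < T} :=
    (measurableSet_Ioi (a := (0 : ℝ))).inter
      (measurableSet_lt ENNReal.measurable_ofReal measurable_const)
  have hpos : ∀ t ∈ {t : ℝ | 0 < t ∧ ENNReal.ofReal t < T}, 0 < t := fun t ht => ht.1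
  have hsub : ∀ t ∈ {t : ℝ | 0 < t ∧ ENNReal.ofReal t < T}, ∀ θ, 0 < θ → θ < 1 →
      θ * t ∈ {t : ℝ | 0 < t ∧ ENNReal.ofReal t < T} := by
    intro t ht θ h0 h1
    refine ⟨mul_pos h0 ht.1, lt_of_le_of_lt (ENNReal.ofReal_le_ofReal ?_) ht.2⟩
    nlinarith [ht.1]
  have h1 := aux_hardy p a r hp ha hr0 hb _ hI hpos hsub u hu hfin
  have h2 := aux_split p a r hp ha ha1 hr1 _ hI hpos u hu
  rw [← hk] at h1
  rw [← hq] at h2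
  refine le_trans ?_ (mul_le_mul_right (le_add_left le_rfl) _)
  rw [← ENNReal.ofReal_rpow_of_nonneg (by positivity) (by positivity),
    ← ENNReal.mul_rpow_of_nonneg _ _ (by positivity)]
  refine ENNReal.rpow_le_rpow (h2.trans ?_) (by positivity)
  set S := ∫⁻ t in {t : ℝ | 0 < t ∧ ENNReal.ofReal t < T}, ∫⁻ s in Ioo (0 : ℝ) t,
    ENNReal.ofReal (s ^ (a * p) * ‖u t - u s‖ ^ p / (t - s) ^ (1 + r * p))
  set H := ∫⁻ t in {t : ℝ | 0 < t ∧ ENNReal.ofReal t < T},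
    ENNReal.ofReal (t ^ ((a - r) * p) * ‖u t‖ ^ p)
  have h3 : H ≤ ENNReal.ofReal (k⁻¹ * 4 ^ (a * p)) * S := by
    have h4 := mul_le_mul_right h1 (ENNReal.ofReal k⁻¹)
    rw [← mul_assoc, ← mul_assoc, ← ENNReal.ofReal_mul (by positivity),
      ← ENNReal.ofReal_mul (by positivity), inv_mul_cancel₀ hk0.ne', ENNReal.ofReal_one,
      one_mul] at h4
    exact h4
  rw [ENNReal.ofReal_mul (by positivity), mul_assoc]
  gcongr
  rw [ENNReal.ofReal_add (by positivity) (by positivity), ENNReal.ofReal_one, add_mul, one_mul,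
    ENNReal.ofReal_mul hq0.le, mul_assoc]
  gcongr
end

section
/- Let X be a real Banach space, p ∈ (1,∞), μ ∈ (1/p,1], r ∈ (0,1), ω ∈ ℝ. Then there exists a constant C = C(p,r,ω) > 0, independent of T ∈ (0,∞), such that for every strongly measurable u : (0,T) → X: (∫_0^T ∫_0^t s^{(1-μ)p} ‖e^{ωt} u(t) - e^{ωs} u(s)‖_X^p (t-s)^{-1-rp} ds dt)^{1/p} ≤ C (∫_0^T t^{(1-μ)p} e^{ωpt} ‖u(t)‖_X^p dt)^{1/p} + (∬_{B_T^1} s^{(1-μ)p} e^{ωps} ‖u(t)-u(s)‖_X^p (t-s)^{-1-rp} ds dt)^{1/p}, where B_T^1 = {(s,t) : 0 < s < t < T, t - s < 1}. -/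
open MeasureTheory Set ENNReal Real

lemma aux_iter (T : ℝ) (b : ℝ → ℝ) (hb : Measurable b) (g : ℝ × ℝ → ℝ≥0∞) (hg : Measurable g) :
    Measurable ({z : ℝ × ℝ | z.1 ∈ Ioo 0 T ∧ z.2 ∈ Ioo (b z.1) z.1}.indicator g) ∧
    ∫⁻ t in Ioo (0 : ℝ) T, ∫⁻ s in Ioo (b t) t, g (t, s)
      = ∫⁻ z, {z : ℝ × ℝ | z.1 ∈ Ioo 0 T ∧ z.2 ∈ Ioo (b z.1) z.1}.indicator g z := by
  have hS : MeasurableSet {z : ℝ × ℝ | z.1 ∈ Ioo 0 T ∧ z.2 ∈ Ioo (b z.1) z.1} := by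
    apply MeasurableSet.inter
    · exact measurable_fst measurableSet_Ioo
    · exact (measurableSet_lt (hb.comp measurable_fst) measurable_snd).inter
        (measurableSet_lt measurable_snd measurable_fst)
  have hm := hg.indicator hS
  refine ⟨hm, ?_⟩
  rw [Measure.volume_eq_prod, lintegral_prod _ hm.aemeasurable, ← lintegral_indicator measurableSet_Ioo]
  congr 1
  ext t
  by_cases ht : t ∈ Ioo 0 T
  · rw [indicator_of_mem ht, ← lintegral_indicator measurableSet_Ioo]
    congr 1
    ext s
    simp only [indicator, mem_ofPred_eq, ht, true_and]
  · rw [indicator_of_notMem ht]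
    have : ∀ s, {z : ℝ × ℝ | z.1 ∈ Ioo 0 T ∧ z.2 ∈ Ioo (b z.1) z.1}.indicator g (t, s) = 0 :=
      fun s => indicator_of_notMem (fun h => ht h.1) _
    simp only [this, lintegral_zero]

lemma aux_ker (p r K : ℝ) (hp : 1 < p) (hr0 : 0 < r) (hr1 : r < 1) :
    ∃ k : ℝ → ℝ≥0∞, Measurable k ∧ ∫⁻ h, k h ≠ ∞ ∧
      (∀ h, 0 < h → h < 1 → ENNReal.ofReal (K * h ^ (p - (1 + r * p))) ≤ k h) ∧
      (∀ h, 1 ≤ h → ENNReal.ofReal (h ^ (-(1 + r * p))) ≤ k h) := by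
  have hm1 : Measurable (fun h : ℝ => ENNReal.ofReal (K * h ^ (p - (1 + r * p)))) := by fun_prop
  have hm2 : Measurable (fun h : ℝ => ENNReal.ofReal (h ^ (-(1 + r * p)))) := by fun_prop
  refine ⟨fun h => (Ioo (0:ℝ) 1).indicator (fun h => ENNReal.ofReal (K * h ^ (p - (1 + r * p)))) h +
    (Ioi (1/2 : ℝ)).indicator (fun h => ENNReal.ofReal (h ^ (-(1 + r * p)))) h,
    (hm1.indicator measurableSet_Ioo).add (hm2.indicator measurableSet_Ioi), ?_, ?_, ?_⟩
  · rw [lintegral_add_left (hm1.indicator measurableSet_Ioo), lintegral_indicator measurableSet_Ioo,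
      lintegral_indicator measurableSet_Ioi]
    refine ENNReal.add_ne_top.2 ⟨?_, ?_⟩
    · have : IntegrableOn (fun h : ℝ => K * h ^ (p - (1 + r * p))) (Ioo 0 1) := by
        apply Integrable.const_mul
        apply (intervalIntegral.integrableOn_Ioo_rpow_iff one_pos).2
        nlinarith
      exact this.lintegral_lt_top.ne
    · have : IntegrableOn (fun h : ℝ => h ^ (-(1 + r * p))) (Ioi (1/2)) := by
        apply integrableOn_Ioi_rpow_of_lt
        · nlinarith
        · norm_num
      exact this.lintegral_lt_top.ne
  · intro h h0 h1
    simp only [indicator_of_mem (show h ∈ Ioo (0:ℝ) 1 from ⟨h0, h1⟩)]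
    exact le_self_add
  · intro h h1
    simp only [indicator_of_mem (show h ∈ Ioi (1/2:ℝ) by simp only [mem_Ioi]; linarith)]
    exact le_add_self

lemma aux_pt (p w x y z : ℝ) (hp : 1 < p) (hw : 0 ≤ w) (hx : 0 ≤ x) (hy : 0 ≤ y) (hz : 0 ≤ z)
    (h : x ≤ y + z) :
    ENNReal.ofReal (w * x ^ p) ≤ (ENNReal.ofReal (w * y ^ p) ^ (1 / p) +
      ENNReal.ofReal (w * z ^ p) ^ (1 / p)) ^ p := by
  have hp0 : 0 < p := by linarith
  have e : ∀ y, 0 ≤ y → ENNReal.ofReal (w * y ^ p) ^ (1 / p) = ENNReal.ofReal (w ^ (1 / p) * y) := by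
    intro y hy
    rw [ENNReal.ofReal_rpow_of_nonneg (by positivity) (by positivity),
      Real.mul_rpow hw (by positivity), ← Real.rpow_mul hy, mul_one_div_cancel hp0.ne', Real.rpow_one]
  rw [e y hy, e z hz, ← ENNReal.ofReal_add (by positivity) (by positivity),
    ENNReal.ofReal_rpow_of_nonneg (by positivity) hp0.le, ← mul_add,
    Real.mul_rpow (by positivity) (by positivity), ← Real.rpow_mul hw, one_div_mul_cancel hp0.ne',
    Real.rpow_one]
  gcongr

lemma aux_exp (ω h : ℝ) (h0 : 0 < h) (h1 : h < 1) :
    |1 - Real.exp (-(ω * h))| ≤ (|ω| * Real.exp |ω|) * h := by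
  have key : |1 - Real.exp (-(ω * h))| ≤ |ω * h| * Real.exp |ω * h| := by
    have := Complex.norm_exp_sub_sum_le_norm_mul_exp ((-(ω * h) : ℝ) : ℂ) 1
    rw [Finset.sum_range_one, pow_zero, Nat.factorial_zero, Nat.cast_one, div_one, pow_one,
      ← Complex.ofReal_exp, ← Complex.ofReal_one, ← Complex.ofReal_sub, Complex.norm_real,
      Complex.norm_real, Real.norm_eq_abs, Real.norm_eq_abs, abs_neg, abs_sub_comm] at this
    exact this
  refine key.trans ?_
  have e : |ω * h| = |ω| * h := by rw [abs_mul, abs_of_pos h0]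
  have l : |ω| * h ≤ |ω| := mul_le_of_le_one_right (abs_nonneg _) h1.le
  rw [e, mul_right_comm]
  gcongr

lemma aux_main {X : Type*} [NormedAddCommGroup X] [NormedSpace ℝ X]
    (p a r ω K : ℝ) (hp : 1 < p) (ha : 0 ≤ a) (hK0 : K = |ω| * Real.exp |ω|)
    (k : ℝ → ℝ≥0∞)
    (hk1 : ∀ h, 0 < h → h < 1 → ENNReal.ofReal (K ^ p * h ^ (p - (1 + r * p))) ≤ k h)
    (hk2 : ∀ h, 1 ≤ h → ENNReal.ofReal (h ^ (-(1 + r * p))) ≤ k h)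
    (t s : ℝ) (hs : 0 < s) (hst : s < t) (x y : X) (G : ℝ≥0∞)
    (hG : t - s < 1 → G = ENNReal.ofReal (s ^ a * Real.exp (ω * p * s) * ‖x - y‖ ^ p
                          / (t - s) ^ (1 + r * p))) :
    ENNReal.ofReal (s ^ a * ‖Real.exp (ω * t) • x - Real.exp (ω * s) • y‖ ^ p
                    / (t - s) ^ (1 + r * p)) ≤
      ((ENNReal.ofReal (t ^ a * Real.exp (ω * p * t) * ‖x‖ ^ p) * k (t - s)) ^ (1 / p) +
      (ENNReal.ofReal (s ^ a * Real.exp (ω * p * s) * ‖y‖ ^ p) * k (t - s)) ^ (1 / p)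
      + G ^ (1 / p)) ^ p := by
  have hp0 : 0 < p := by linarith
  have hh : 0 < t - s := by linarith
  have hK : 0 ≤ K := by rw [hK0]; positivity
  have ht : 0 < t := by linarith
  have ee : ∀ q : ℝ, Real.exp (ω * p * q) = Real.exp (ω * q) ^ p := by
    intro q; rw [← Real.exp_mul]; ring_nf
  have hsa : s ^ a ≤ t ^ a := Real.rpow_le_rpow hs.le hst.le ha
  rw [mul_div_right_comm]
  rcases lt_or_ge (t - s) 1 with h1 | h1
  · have tri : ‖Real.exp (ω * t) • x - Real.exp (ω * s) • y‖ ≤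
        Real.exp (ω * t) * (K * (t - s)) * ‖x‖ + Real.exp (ω * s) * ‖x - y‖ := by
      have e1 : Real.exp (ω * t) • x - Real.exp (ω * s) • y =
          (Real.exp (ω * t) * (1 - Real.exp (-(ω * (t - s))))) • x + Real.exp (ω * s) • (x - y) := by
        rw [mul_sub, ← Real.exp_add, show ω * t + -(ω * (t - s)) = ω * s by ring]
        module
      rw [e1]
      refine (norm_add_le _ _).trans ?_
      rw [norm_smul, norm_smul, norm_mul, Real.norm_eq_abs, Real.norm_eq_abs, Real.norm_eq_abs,
        Real.abs_exp, Real.abs_exp]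
      gcongr
      rw [hK0]
      exact aux_exp ω _ hh h1
    refine (aux_pt p _ _ _ _ hp (by positivity) (by positivity) (by positivity) (by positivity) tri).trans ?_
    gcongr ?_ ^ p
    refine add_le_add ?_ ?_
    · refine le_trans ?_ le_self_add
      gcongr ?_ ^ (1 / p)
      refine le_trans ?_ (mul_le_mul_right (hk1 _ hh h1) _)
      rw [← ENNReal.ofReal_mul (by positivity)]
      apply ENNReal.ofReal_le_ofReal
      rw [Real.mul_rpow (by positivity) (by positivity), Real.mul_rpow (by positivity) (by positivity),
        Real.mul_rpow (by positivity) (by positivity), ee, Real.rpow_sub hh]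
      calc _ = s ^ a * (Real.exp (ω * t) ^ p * ‖x‖ ^ p * (K ^ p * ((t - s) ^ p / (t - s) ^ (1 + r * p)))) := by
            ring
        _ ≤ t ^ a * (Real.exp (ω * t) ^ p * ‖x‖ ^ p * (K ^ p * ((t - s) ^ p / (t - s) ^ (1 + r * p)))) := by
            gcongr
        _ = _ := by ring
    · rw [hG h1, Real.mul_rpow (by positivity) (by positivity), ee]
      apply le_of_eq
      congr 2
      ring
  · have tri : ‖Real.exp (ω * t) • x - Real.exp (ω * s) • y‖ ≤
        Real.exp (ω * t) * ‖x‖ + Real.exp (ω * s) * ‖y‖ := by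
      refine (norm_sub_le _ _).trans ?_
      rw [norm_smul, norm_smul, Real.norm_eq_abs, Real.norm_eq_abs,
        Real.abs_exp, Real.abs_exp]
    refine (aux_pt p _ _ _ _ hp (by positivity) (by positivity) (by positivity) (by positivity) tri).trans ?_
    gcongr ?_ ^ p
    refine le_trans ?_ le_self_add
    refine add_le_add ?_ ?_
    · gcongr ?_ ^ (1 / p)
      refine le_trans ?_ (mul_le_mul_right (hk2 _ h1) _)
      rw [← ENNReal.ofReal_mul (by positivity)]
      apply ENNReal.ofReal_le_ofReal
      rw [Real.mul_rpow (by positivity) (by positivity), ee, Real.rpow_neg hh.le]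
      calc _ = s ^ a * (Real.exp (ω * t) ^ p * ‖x‖ ^ p * ((t - s) ^ (1 + r * p))⁻¹) := by
            ring
        _ ≤ t ^ a * (Real.exp (ω * t) ^ p * ‖x‖ ^ p * ((t - s) ^ (1 + r * p))⁻¹) := by
            gcongr
        _ = _ := by ring
    · gcongr ?_ ^ (1 / p)
      refine le_trans ?_ (mul_le_mul_right (hk2 _ h1) _)
      rw [← ENNReal.ofReal_mul (by positivity)]
      apply ENNReal.ofReal_le_ofReal
      rw [Real.mul_rpow (by positivity) (by positivity), ee, Real.rpow_neg hh.le]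
      apply le_of_eq
      ring

/-- Lemma A.5 of the paper, first inequality: for `p ∈ (1,∞)`, `μ ∈ (1/p,1]`,
`r ∈ (0,1)`, `ω ∈ ℝ`, there is `C = C(p,r,ω) > 0` independent of `T ∈ (0,∞)` such that
the weighted Sobolev–Slobodeckij seminorm of `e_ω u : t ↦ e^{ωt} u(t)` is bounded by
`C ‖e_ω u‖_{L_{p,μ}}` plus the part of the seminorm restricted to
`B_T^1 = {(s,t) : 0 < s < t < T, t - s < 1}`. -/
theorem stmt_6 {X : Type*} [NormedAddCommGroup X] [NormedSpace ℝ X] [CompleteSpace X]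
    (p μ r ω : ℝ) (hp : 1 < p) (hμ : 1 / p < μ) (hμ1 : μ ≤ 1)
    (hr0 : 0 < r) (hr1 : r < 1) :
    ∃ C : ℝ, 0 < C ∧
      ∀ T : ℝ, 0 < T →
        ∀ u : ℝ → X, StronglyMeasurable u →
          (∫⁻ t in Ioo (0 : ℝ) T,
              ∫⁻ s in Ioo (0 : ℝ) t,
                ENNReal.ofReal
                  (s ^ ((1 - μ) * p) * ‖Real.exp (ω * t) • u t - Real.exp (ω * s) • u s‖ ^ p
                    / (t - s) ^ (1 + r * p))) ^ (1 / p)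
            ≤ ENNReal.ofReal C *
                (∫⁻ t in Ioo (0 : ℝ) T,
                    ENNReal.ofReal
                      (t ^ ((1 - μ) * p) * Real.exp (ω * p * t) * ‖u t‖ ^ p)) ^ (1 / p)
              + (∫⁻ t in Ioo (0 : ℝ) T,
                    ∫⁻ s in Ioo (max (t - 1) 0) t,
                      ENNReal.ofReal
                        (s ^ ((1 - μ) * p) * Real.exp (ω * p * s) * ‖u t - u s‖ ^ p
                          / (t - s) ^ (1 + r * p))) ^ (1 / p) := by
  have hp0 : 0 < p := by linarith
  obtain ⟨k, hkm, hki, hk1, hk2⟩ := aux_ker p r ((|ω| * Real.exp |ω|) ^ p) hp hr0 hr1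
  set I := ∫⁻ h, k h with hI
  refine ⟨2 * I.toReal ^ (1 / p) + 1, by positivity, ?_⟩
  intro T hT u hu
  have ha : 0 ≤ (1 - μ) * p := mul_nonneg (by linarith) hp0.le
  set a := (1 - μ) * p with haa
  have hun : Measurable fun t => ‖u t‖ := hu.norm.measurable
  have hu1 : StronglyMeasurable fun z : ℝ × ℝ => u z.1 := hu.comp_measurable measurable_fst
  have hu2 : StronglyMeasurable fun z : ℝ × ℝ => u z.2 := hu.comp_measurable measurable_snd
  have hud : Measurable fun z : ℝ × ℝ => ‖u z.1 - u z.2‖ := (hu1.sub hu2).norm.measurable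
  have hue : Measurable fun z : ℝ × ℝ =>
      ‖Real.exp (ω * z.1) • u z.1 - Real.exp (ω * z.2) • u z.2‖ := by
    refine StronglyMeasurable.measurable (StronglyMeasurable.norm (StronglyMeasurable.sub
      (StronglyMeasurable.smul ?_ hu1) (StronglyMeasurable.smul ?_ hu2)))
    · exact Measurable.stronglyMeasurable (by fun_prop)
    · exact Measurable.stronglyMeasurable (by fun_prop)
  obtain ⟨hFm, hF⟩ := aux_iter T (fun _ => 0) measurable_const (fun z => ENNReal.ofReal
    (z.2 ^ a * ‖Real.exp (ω * z.1) • u z.1 - Real.exp (ω * z.2) • u z.2‖ ^ p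
                    / (z.1 - z.2) ^ (1 + r * p))) (by fun_prop)
  obtain ⟨hGm, hG⟩ := aux_iter T (fun t => max (t - 1) 0) (by fun_prop) (fun z => ENNReal.ofReal
    (z.2 ^ a * Real.exp (ω * p * z.2) * ‖u z.1 - u z.2‖ ^ p
                    / (z.1 - z.2) ^ (1 + r * p))) (by fun_prop)
  rw [hF, hG]
  clear hF hG
  set F := {z : ℝ × ℝ | z.1 ∈ Ioo 0 T ∧ z.2 ∈ Ioo 0 z.1}.indicator (fun z => ENNReal.ofReal
    (z.2 ^ a * ‖Real.exp (ω * z.1) • u z.1 - Real.exp (ω * z.2) • u z.2‖ ^ p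
                    / (z.1 - z.2) ^ (1 + r * p))) with hFd
  set G := {z : ℝ × ℝ | z.1 ∈ Ioo 0 T ∧ z.2 ∈ Ioo (max (z.1 - 1) 0) z.1}.indicator
    (fun z => ENNReal.ofReal
    (z.2 ^ a * Real.exp (ω * p * z.2) * ‖u z.1 - u z.2‖ ^ p
                    / (z.1 - z.2) ^ (1 + r * p))) with hGd
  rw [← lintegral_indicator measurableSet_Ioo]
  have hφm : Measurable ((Ioo (0:ℝ) T).indicator fun t => ENNReal.ofReal
    (t ^ a * Real.exp (ω * p * t) * ‖u t‖ ^ p)) :=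
    Measurable.indicator (by fun_prop) measurableSet_Ioo
  set φ := (Ioo (0:ℝ) T).indicator fun t => ENNReal.ofReal
    (t ^ a * Real.exp (ω * p * t) * ‖u t‖ ^ p) with hφ
  have hpt : ∀ z, F z ≤ ((φ z.1 * k (z.1 - z.2)) ^ (1 / p) + (φ z.2 * k (z.1 - z.2)) ^ (1 / p)
      + G z ^ (1 / p)) ^ p := by
    rintro ⟨t, s⟩
    by_cases hz : t ∈ Ioo 0 T ∧ s ∈ Ioo 0 t
    · have hs' : s ∈ Ioo 0 T := ⟨hz.2.1, hz.2.2.trans hz.1.2⟩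
      have e1 : F (t, s) = ENNReal.ofReal (s ^ a * ‖Real.exp (ω * t) • u t - Real.exp (ω * s) • u s‖ ^ p
                    / (t - s) ^ (1 + r * p)) := by
        rw [hFd]; exact indicator_of_mem (show (t, s) ∈ {z : ℝ × ℝ | z.1 ∈ Ioo 0 T ∧ z.2 ∈ Ioo 0 z.1} from hz) _
      rw [e1]
      simp only [hφ, indicator_of_mem hz.1, indicator_of_mem hs']
      refine aux_main p a r ω _ hp ha rfl k hk1 hk2 t s hz.2.1 hz.2.2 _ _ _ ?_
      intro h1
      rw [hGd]
      refine indicator_of_mem (show (t, s) ∈ {z : ℝ × ℝ | z.1 ∈ Ioo 0 T ∧ z.2 ∈ Ioo (max (z.1 - 1) 0) z.1} from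
        ⟨hz.1, max_lt (by simp only; linarith) hz.2.1, hz.2.2⟩) _
    · have e1 : F (t, s) = 0 := by
        rw [hFd]; exact indicator_of_notMem (show (t, s) ∉ {z : ℝ × ℝ | z.1 ∈ Ioo 0 T ∧ z.2 ∈ Ioo 0 z.1} from hz) _
      rw [e1]; exact zero_le
  have hA : Measurable fun z : ℝ × ℝ => φ z.1 * k (z.1 - z.2) := by fun_prop
  have hB : Measurable fun z : ℝ × ℝ => φ z.2 * k (z.1 - z.2) := by fun_prop
  have iA : ∫⁻ z : ℝ × ℝ, φ z.1 * k (z.1 - z.2) = (∫⁻ t, φ t) * I := by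
    rw [Measure.volume_eq_prod, lintegral_prod _ hA.aemeasurable, ← lintegral_mul_const _ hφm]
    congr 1; ext t
    simp only
    rw [lintegral_const_mul _ (by fun_prop), lintegral_sub_left_eq_self k t]
  have iB : ∫⁻ z : ℝ × ℝ, φ z.2 * k (z.1 - z.2) = (∫⁻ t, φ t) * I := by
    rw [Measure.volume_eq_prod, lintegral_prod_symm _ hB.aemeasurable, ← lintegral_mul_const _ hφm]
    congr 1; ext t
    simp only
    rw [lintegral_const_mul _ (by fun_prop), lintegral_sub_right_eq_self k t]
  have pp : ∀ x : ℝ≥0∞, (x ^ (1 / p)) ^ p = x := by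
    intro x; rw [← ENNReal.rpow_mul, one_div_mul_cancel hp0.ne', ENNReal.rpow_one]
  have m1 := ENNReal.lintegral_Lp_add_le (μ := (volume : Measure (ℝ × ℝ)))
    ((hA.pow_const (1 / p)).add (hB.pow_const (1 / p))).aemeasurable
    (hGm.pow_const (1 / p)).aemeasurable hp.le
  have m2 := ENNReal.lintegral_Lp_add_le (μ := (volume : Measure (ℝ × ℝ)))
    (hA.pow_const (1 / p)).aemeasurable (hB.pow_const (1 / p)).aemeasurable hp.le
  simp only [Pi.add_apply, pp] at m1 m2
  rw [iA, iB] at m2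
  calc _ ≤ _ := ENNReal.rpow_le_rpow (lintegral_mono hpt) (by positivity)
    _ ≤ _ := m1
    _ ≤ _ := by
      refine add_le_add (m2.trans ?_) le_rfl
      rw [ENNReal.mul_rpow_of_nonneg _ _ (by positivity), ← two_mul, mul_comm (_ ^ _) (I ^ _), ← mul_assoc]
      refine mul_le_mul_left ?_ _
      rw [ENNReal.ofReal_add (by positivity) (by positivity), ENNReal.ofReal_mul (by positivity),
        ← ENNReal.ofReal_rpow_of_nonneg (by positivity) (by positivity), ENNReal.ofReal_toReal hki]
      refine le_trans ?_ le_self_add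
      simp
end
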